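/- If compact sets $K_n \subset \overline\Omega$ with at most $m$ connected components converge to $K$ in the Hausdorff metric, then for every open set $U \subset \mathbb{R}^2$ the one-dimensional Hausdorff measure satisfies $\mathcal{H}^1(K\cap U) \le \liminf_{n\to\infty} \mathcal{H}^1(K_n\cap U)$. -/

import Mathlib

open Filter MeasureTheory Set
open scoped Topology ENNReal NNReal

section Components

variable {X : Type*} [TopologicalSpace X]

/-- The connected component of a point in a closed set is closed. -/
theorem IsClosed.isClosed_connectedComponentIn {F : Set X} (hF : IsClosed F) (x : X) :
    IsClosed (connectedComponentIn F x) := by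
  by_cases hx : x ∈ F
  · rw [connectedComponentIn_eq_image hx]
    exact hF.isClosedEmbedding_subtypeVal.isClosedMap _ isClosed_connectedComponent
  · rw [connectedComponentIn_eq_empty hx]
    exact isClosed_empty

/-- Two connected components of a set that have a common point coincide. -/
theorem connectedComponentIn_eq_of_inter_nonempty {F : Set X} {x y : X}
    (h : (connectedComponentIn F x ∩ connectedComponentIn F y).Nonempty) :
    connectedComponentIn F x = connectedComponentIn F y := by
  obtain ⟨z, hzx, hzy⟩ := h
  rw [connectedComponentIn_eq hzx, connectedComponentIn_eq hzy]

/-- In a compact Hausdorff set, a connected component contained in an open set `O` is contained in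
a relatively clopen subset of `O`. -/
theorem IsCompact.exists_clopen_of_connectedComponentIn_subset [T2Space X] {F O : Set X} {x : X}
    (hF : IsCompact F) (hx : x ∈ F) (hO : IsOpen O) (h : connectedComponentIn F x ⊆ O) :
    ∃ Z ⊆ F, x ∈ Z ∧ Z ⊆ O ∧ IsCompact Z ∧ IsCompact (F \ Z) := by
  have := isCompact_iff_compactSpace.1 hF
  rw [connectedComponentIn_eq_image hx, image_subset_iff,
    connectedComponent_eq_iInter_isClopen] at h
  have : Nonempty { s : Set F // IsClopen s ∧ (⟨x, hx⟩ : F) ∈ s } :=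
    ⟨⟨univ, isClopen_univ, mem_univ _⟩⟩
  obtain ⟨⟨s, hs, hxs⟩, hsO⟩ := exists_subset_nhds_of_compactSpace
    (V := fun s : { s : Set F // IsClopen s ∧ (⟨x, hx⟩ : F) ∈ s } => (s : Set F))
    (fun s t => ⟨⟨s ∩ t, s.2.1.inter t.2.1, s.2.2, t.2.2⟩, inter_subset_left, inter_subset_right⟩)
    (fun s => s.2.1.1)
    (fun y hy => (hO.preimage continuous_subtype_val).mem_nhds (h hy))
  refine ⟨(↑) '' s, Subtype.coe_image_subset F s, ⟨_, hxs, rfl⟩, image_subset_iff.2 hsO,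
    hs.1.isCompact.image continuous_subtype_val, ?_⟩
  have : F \ ((↑) '' s) = ((↑) '' sᶜ : Set X) := by
    ext y
    simp
  rw [this]
  exact hs.compl.1.isCompact.image continuous_subtype_val

/-- Boundary bumping: the component of `x` in `K ∩ F` either leaves the open set `O ⊆ F` or is a
full component of `K`. -/
theorem connectedComponentIn_inter_eq_of_subset [T2Space X] {K F O : Set X} {x : X}
    (hK : IsCompact K) (hF : IsClosed F) (hO : IsOpen O) (hOF : O ⊆ F) (hxK : x ∈ K) (hxF : x ∈ F)
    (h : connectedComponentIn (K ∩ F) x ⊆ O) :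
    connectedComponentIn (K ∩ F) x = connectedComponentIn K x := by
  refine (connectedComponentIn_mono x inter_subset_left).antisymm ?_
  obtain ⟨Z, hZF, hxZ, hZO, hZ, hZc⟩ :=
    (hK.inter_right hF).exists_clopen_of_connectedComponentIn_subset ⟨hxK, hxF⟩ hO h
  have hcl : IsClosed (K \ Z) := by
    have : K \ Z = (K ∩ F) \ Z ∪ K \ O := by
      ext y
      have := @hOF y
      have := @hZO y
      simp only [Set.mem_union, Set.mem_sdiff, Set.mem_inter_iff]
      tauto
    rw [this]
    exact hZc.isClosed.union (hK.diff hO).isClosed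
  have hsub : connectedComponentIn K x ⊆ Z := by
    intro y hy
    by_contra hyZ
    obtain ⟨z, -, hz, hz'⟩ := isPreconnected_closed_iff.1
      (isPreconnected_connectedComponentIn (x := x) (F := K)) Z (K \ Z) hZ.isClosed hcl
      (fun z hz => by
        by_cases hzZ : z ∈ Z
        · exact Or.inl hzZ
        · exact Or.inr ⟨connectedComponentIn_subset _ _ hz, hzZ⟩)
      ⟨x, mem_connectedComponentIn hxK, hxZ⟩
      ⟨y, hy, connectedComponentIn_subset _ _ hy, hyZ⟩
    exact hz'.2 hz
  exact isPreconnected_connectedComponentIn.subset_connectedComponentIn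
    (mem_connectedComponentIn hxK) (hsub.trans hZF)

/-- Among more than `m` points of a set with at most `m` components, two lie in the same
component. -/
theorem exists_connectedComponentIn_eq_of_card_lt {K : Set X} {m : ℕ}
    (hfin : Finite (ConnectedComponents K)) (hcard : Nat.card (ConnectedComponents K) ≤ m)
    {ι : Type*} [Fintype ι] (hι : m < Fintype.card ι) (x : ι → X) (hx : ∀ i, x i ∈ K) :
    ∃ i j, i ≠ j ∧ connectedComponentIn K (x i) = connectedComponentIn K (x j) := by
  have := Fintype.ofFinite (ConnectedComponents K)
  rw [Nat.card_eq_fintype_card] at hcard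
  obtain ⟨i, j, hij, h⟩ := Fintype.exists_ne_map_eq_of_card_lt
    (fun i => ((⟨x i, hx i⟩ : K) : ConnectedComponents K)) (hcard.trans_lt hι)
  refine ⟨i, j, hij, ?_⟩
  rw [connectedComponentIn_eq_image (hx i), connectedComponentIn_eq_image (hx j),
    ConnectedComponents.coe_eq_coe.1 h]

end Components

section HausdorffLimit

variable {X : Type*} [MetricSpace X]

/-- A limit of compact sets with at most `m` components has finitely many singleton components. -/
theorem finite_setOf_connectedComponentIn_subset_singleton {K : ℕ → Set X} {Klim : Set X} {m : ℕ}
    (hfin : ∀ n, Finite (ConnectedComponents (K n)))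
    (hcard : ∀ n, Nat.card (ConnectedComponents (K n)) ≤ m) (hKlim : IsCompact Klim)
    (hconv : ∀ δ > 0, ∀ᶠ n in atTop, Klim ⊆ Metric.thickening δ (K n))
    (hconv' : ∀ δ > 0, ∀ᶠ n in atTop, K n ⊆ Metric.thickening δ Klim) :
    {x ∈ Klim | connectedComponentIn Klim x ⊆ {x}}.Finite := by
  classical
  by_contra hinf
  obtain ⟨T, hT, hTm⟩ := Set.Infinite.exists_subset_card_eq hinf (m + 1)
  have hsep : ∀ x : T, ∃ Z ⊆ Klim, (x : X) ∈ Z ∧ Z ⊆ ((T.erase x : Finset X) : Set X)ᶜ ∧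
      IsCompact Z ∧ IsCompact (Klim \ Z) := fun x =>
    hKlim.exists_clopen_of_connectedComponentIn_subset (hT x.2).1
      (T.erase x).finite_toSet.isClosed.isOpen_compl ((hT x.2).2.trans (by simp))
  choose Z hZK hxZ hZT hZ hZc using hsep
  have hη : ∀ x : T, ∀ᶠ η : ℝ in 𝓝[>] 0,
      Disjoint (Metric.thickening η (Z x)) (Metric.thickening η (Klim \ Z x)) := by
    intro x
    obtain ⟨η, hη, hd⟩ := disjoint_sdiff_right.exists_thickenings (hZ x) (hZc x).isClosed
    filter_upwards [Ioo_mem_nhdsGT hη] with η' hη'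
    exact hd.mono (Metric.thickening_mono hη'.2.le _) (Metric.thickening_mono hη'.2.le _)
  obtain ⟨η, hd, hη0⟩ := ((eventually_all.2 hη).and self_mem_nhdsWithin).exists
  obtain ⟨n, hn, hn'⟩ := ((hconv η hη0).and (hconv' η hη0)).exists
  have hy : ∀ x : T, ∃ y ∈ K n, dist (x : X) y < η :=
    fun x => Metric.mem_thickening_iff.1 (hn (hT x.2).1)
  choose y hyK hxy using hy
  obtain ⟨i, j, hij, h⟩ := exists_connectedComponentIn_eq_of_card_lt (hfin n) (hcard n)
    (by rw [Fintype.card_coe, hTm]; exact m.lt_succ_self) y hyK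
  have hyi : y i ∈ Metric.thickening η (Z i) :=
    Metric.mem_thickening_iff.2 ⟨i, hxZ i, by rw [dist_comm]; exact hxy i⟩
  have hyj : y j ∈ Metric.thickening η (Klim \ Z i) := by
    refine Metric.mem_thickening_iff.2 ⟨j, ⟨(hT j.2).1, fun hj => hZT i hj ?_⟩, ?_⟩
    · exact Finset.mem_coe.2 (Finset.mem_erase.2 ⟨fun hji => hij (Subtype.ext hji.symm), j.2⟩)
    · rw [dist_comm]
      exact hxy j
  have hcov : K n ⊆ Metric.thickening η (Z i) ∪ Metric.thickening η (Klim \ Z i) := by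
    rw [← Metric.thickening_union, union_sdiff_cancel (hZK i)]
    exact hn'
  have hsub := isPreconnected_connectedComponentIn.subset_left_of_subset_union
    Metric.isOpen_thickening Metric.isOpen_thickening (hd i)
    ((connectedComponentIn_subset (K n) (y i)).trans hcov)
    ⟨y i, mem_connectedComponentIn (hyK i), hyi⟩
  exact disjoint_left.1 (hd i) (hsub (h ▸ mem_connectedComponentIn (hyK j))) hyj

end HausdorffLimit

section Liminf

theorem ENNReal.liminf_add_liminf_le (f g : ℕ → ℝ≥0∞) :
    atTop.liminf f + atTop.liminf g ≤ atTop.liminf (fun n => f n + g n) := by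
  simp only [liminf_eq_iSup_iInf_of_nat]
  rw [ENNReal.iSup_add_iSup_of_monotone]
  · gcongr with n
    exact le_iInf₂ fun i hi => add_le_add (iInf₂_le i hi) (iInf₂_le i hi)
  · exact fun a b hab => le_iInf₂ fun i hi => iInf₂_le i (hab.trans hi)
  · exact fun a b hab => le_iInf₂ fun i hi => iInf₂_le i (hab.trans hi)

end Liminf

section HausdorffMeasure

variable {X : Type*} [MetricSpace X] [MeasurableSpace X] [BorelSpace X]

/-- The diameter of a preconnected set is at most its one-dimensional Hausdorff measure. -/
theorem IsPreconnected.ediam_le_hausdorffMeasure {C : Set X} (hC : IsPreconnected C) :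
    Metric.ediam C ≤ μH[1] C := by
  refine Metric.ediam_le fun x hx y hy => ?_
  have hf : LipschitzWith 1 (fun z => dist z x) := LipschitzWith.dist_left x
  have hI : Icc 0 (dist y x) ⊆ (fun z => dist z x) '' C := by
    have := (hC.image _ hf.continuous.continuousOn).Icc_subset ⟨x, hx, rfl⟩ ⟨y, hy, rfl⟩
    simpa using this
  calc edist x y = volume (Icc 0 (dist y x)) := by
        rw [Real.volume_Icc, sub_zero, edist_comm, edist_dist]
    _ ≤ volume ((fun z => dist z x) '' C) := measure_mono hI
    _ = μH[1] ((fun z => dist z x) '' C) := by rw [hausdorffMeasure_real]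
    _ ≤ μH[1] C := by simpa using hf.hausdorffMeasure_image_le zero_le_one C

/-- Quantitative lower bound: if a compact set `K` with at most `m` components is `δ`-dense near a
preconnected set `γ`, its length in the `w`-neighbourhood of `γ` is almost the diameter of `γ`. -/
theorem ediam_le_hausdorffMeasure_add_of_subset_thickening {K γ V : Set X} {m : ℕ}
    (hK : IsCompact K) (hfin : Finite (ConnectedComponents K))
    (hcard : Nat.card (ConnectedComponents K) ≤ m) (hγ : IsPreconnected γ) {w δ : ℝ≥0}
    (hw : 0 < w) (hδ : 2 * δ ≤ w) (hV : Metric.cthickening w γ ⊆ V)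
    (hγK : γ ⊆ Metric.thickening δ K) :
    Metric.ediam γ ≤ μH[1] (K ∩ V) + (m + μH[1] (K ∩ V) / ((w / 2 : ℝ≥0) : ℝ≥0∞)) * (2 * δ) := by
  rcases eq_or_ne (μH[1] (K ∩ V)) ∞ with htop | htop
  · simp [htop]
  have hw2 : ((w / 2 : ℝ≥0) : ℝ≥0∞) ≠ 0 := by simpa using hw.ne'
  set F := Metric.cthickening w γ with hF
  have hXc : IsClosed (K ∩ F) := hK.isClosed.inter Metric.isClosed_cthickening
  have hδw : (δ : ℝ) ≤ w := by
    have : (2 * δ : ℝ) ≤ w := by exact_mod_cast hδ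
    linarith [δ.coe_nonneg]
  let S : Set (Set X) :=
    {C | ∃ q ∈ K, q ∈ Metric.thickening δ γ ∧ C = connectedComponentIn (K ∩ F) q}
  have hsubF : Metric.thickening δ γ ⊆ F :=
    (Metric.thickening_mono hδw γ).trans (Metric.thickening_subset_cthickening _ _)
  have hsum : ∀ T : Finset (Set X), (T : Set (Set X)) ⊆ S →
      ∑ C ∈ T, μH[1] C ≤ μH[1] (K ∩ V) := by
    intro T hT
    rw [← measure_biUnion_finset (f := fun C => C)]
    · refine measure_mono (iUnion₂_subset fun C hC => ?_)
      obtain ⟨q, -, -, rfl⟩ := hT hC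
      exact (connectedComponentIn_subset _ _).trans (inter_subset_inter_right _ hV)
    · intro C hC D hD hCD
      obtain ⟨q, -, -, rfl⟩ := hT hC
      obtain ⟨q', -, -, rfl⟩ := hT hD
      by_contra hdis
      exact hCD (connectedComponentIn_eq_of_inter_nonempty (not_disjoint_iff_nonempty_inter.1 hdis))
    · intro C hC
      obtain ⟨q, -, -, rfl⟩ := hT hC
      exact (hXc.isClosed_connectedComponentIn q).measurableSet
  have hTcard : ∀ T : Finset (Set X), (T : Set (Set X)) ⊆ S →
      (T.card : ℝ≥0∞) ≤ m + μH[1] (K ∩ V) / ((w / 2 : ℝ≥0) : ℝ≥0∞) := by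
    classical
    intro T hT
    rw [← T.card_filter_add_card_filter_not (fun C => ((w / 2 : ℝ≥0) : ℝ≥0∞) ≤ μH[1] C), add_comm,
      Nat.cast_add]
    refine add_le_add ?_ ?_
    · rw [Nat.cast_le]
      refine not_lt.1 fun hlt => ?_
      set T' := T.filter (fun C => ¬ ((w / 2 : ℝ≥0) : ℝ≥0∞) ≤ μH[1] C)
      have hrep : ∀ C : T', ∃ q ∈ K, (C : Set X) = connectedComponentIn K q := by
        rintro ⟨C, hC⟩
        obtain ⟨hCT, hCw⟩ := Finset.mem_filter.1 hC
        obtain ⟨q, hqK, hq, rfl⟩ := hT hCT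
        refine ⟨q, hqK, ?_⟩
        refine connectedComponentIn_inter_eq_of_subset hK Metric.isClosed_cthickening
          (Metric.isOpen_thickening (δ := w) (E := γ))
          (Metric.thickening_subset_cthickening _ _) hqK (hsubF hq) ?_
        intro y hy
        by_contra hyw
        refine hCw (le_trans ?_ isPreconnected_connectedComponentIn.ediam_le_hausdorffMeasure)
        refine le_trans ?_
          (Metric.edist_le_ediam_of_mem hy (mem_connectedComponentIn ⟨hqK, hsubF hq⟩))
        obtain ⟨p, hp, hqp⟩ := Metric.mem_thickening_iff.1 hq
        have h1 : (w : ℝ) ≤ dist y p := by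
          by_contra! hlt
          exact hyw (Metric.mem_thickening_iff.2 ⟨p, hp, hlt⟩)
        have h2 : (2 * δ : ℝ) ≤ w := by exact_mod_cast hδ
        rw [edist_nndist, ENNReal.coe_le_coe, ← NNReal.coe_le_coe, coe_nndist]
        push_cast
        linarith [dist_triangle y q p]
      choose q hqK hq using hrep
      obtain ⟨i, j, hij, h⟩ := exists_connectedComponentIn_eq_of_card_lt hfin hcard
        (by rwa [Fintype.card_coe]) q hqK
      exact hij (Subtype.ext (by rw [hq i, hq j, h]))
    · rw [ENNReal.le_div_iff_mul_le (Or.inl hw2) (Or.inl ENNReal.coe_ne_top)]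
      refine le_trans ?_ (hsum (T.filter (fun C => ((w / 2 : ℝ≥0) : ℝ≥0∞) ≤ μH[1] C))
        ((Finset.coe_subset.2 (Finset.filter_subset _ T)).trans hT))
      rw [← nsmul_eq_mul]
      exact Finset.card_nsmul_le_sum _ _ _ fun C hC => (Finset.mem_filter.1 hC).2
  have hSfin : S.Finite := by
    by_contra hinf
    have hfinite : m + μH[1] (K ∩ V) / ((w / 2 : ℝ≥0) : ℝ≥0∞) ≠ ∞ :=
      ENNReal.add_ne_top.2 ⟨ENNReal.natCast_ne_top m, ENNReal.div_ne_top htop hw2⟩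
    obtain ⟨n, hn⟩ := ENNReal.exists_nat_gt hfinite
    obtain ⟨T, hTS, hTn⟩ := Set.Infinite.exists_subset_card_eq hinf n
    exact absurd (hTcard T hTS) (by rw [hTn]; exact hn.not_ge)
  have hST : (hSfin.toFinset : Set (Set X)) ⊆ S := by simp
  refine Metric.ediam_le fun a ha b hb => ?_
  have hf : LipschitzWith 1 (fun z => dist z a) := LipschitzWith.dist_left a
  have hI : Icc 0 (dist b a) ⊆
      ⋃ C ∈ hSfin.toFinset, Metric.thickening δ ((fun z => dist z a) '' C) := by
    intro t ht
    have := (hγ.image _ hf.continuous.continuousOn).Icc_subset ⟨a, ha, rfl⟩ ⟨b, hb, rfl⟩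
    obtain ⟨p, hp, rfl⟩ := this (by simpa using ht)
    obtain ⟨q, hqK, hpq⟩ := Metric.mem_thickening_iff.1 (hγK hp)
    have hq : q ∈ Metric.thickening δ γ :=
      Metric.mem_thickening_iff.2 ⟨p, hp, by rwa [dist_comm]⟩
    refine mem_iUnion₂.2 ⟨connectedComponentIn (K ∩ F) q,
      hSfin.mem_toFinset.2 ⟨q, hqK, hq, rfl⟩, Metric.mem_thickening_iff.2
        ⟨dist q a, ⟨q, mem_connectedComponentIn ⟨hqK, hsubF hq⟩, rfl⟩, ?_⟩⟩
    exact (by simpa using hf.dist_le_mul p q : dist (dist p a) (dist q a) ≤ dist p q).trans_lt hpq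
  calc edist a b = volume (Icc 0 (dist b a)) := by
        rw [Real.volume_Icc, sub_zero, edist_comm, edist_dist]
    _ ≤ ∑ C ∈ hSfin.toFinset, volume (Metric.thickening δ ((fun z => dist z a) '' C)) :=
        (measure_mono hI).trans (measure_biUnion_finset_le _ _)
    _ ≤ ∑ C ∈ hSfin.toFinset, (μH[1] C + 2 * δ) := by
        refine Finset.sum_le_sum fun C hC => ?_
        obtain ⟨q, -, -, rfl⟩ := hSfin.mem_toFinset.1 hC
        refine (Real.volume_le_diam _).trans ((Metric.ediam_thickening_le δ).trans ?_)
        gcongr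
        refine le_trans ?_ isPreconnected_connectedComponentIn.ediam_le_hausdorffMeasure
        simpa using hf.ediam_image_le (connectedComponentIn (K ∩ F) q)
    _ = ∑ C ∈ hSfin.toFinset, μH[1] C + hSfin.toFinset.card * (2 * δ) := by
        rw [Finset.sum_add_distrib, Finset.sum_const, nsmul_eq_mul]
    _ ≤ _ := by
        gcongr
        · exact hsum _ hST
        · exact hTcard _ hST

/-- The diameter of a continuum in the limit set is at most the lower limit of the lengths of the
approximating sets near that continuum. -/
theorem ediam_le_liminf_hausdorffMeasure {K : ℕ → Set X} {Klim γ V : Set X} {m : ℕ}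
    (hK : ∀ n, IsCompact (K n)) (hfin : ∀ n, Finite (ConnectedComponents (K n)))
    (hcard : ∀ n, Nat.card (ConnectedComponents (K n)) ≤ m)
    (hconv : ∀ δ > 0, ∀ᶠ n in atTop, Klim ⊆ Metric.thickening δ (K n))
    (hγ : IsCompact γ) (hγc : IsPreconnected γ) (hγK : γ ⊆ Klim) (hV : IsOpen V) (hγV : γ ⊆ V) :
    Metric.ediam γ ≤ atTop.liminf (fun n => μH[1] (K n ∩ V)) := by
  refine le_of_forall_lt fun c hc => ?_
  obtain ⟨c', hcc', hc'⟩ := exists_between hc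
  refine hcc'.trans_le (le_liminf_of_le (by isBoundedDefault) ?_)
  obtain ⟨w', hw', hwV⟩ := hγ.exists_cthickening_subset_open hV hγV
  lift w' to ℝ≥0 using hw'.le with w
  have hw : 0 < w := by exact_mod_cast hw'
  have hw2 : ((w / 2 : ℝ≥0) : ℝ≥0∞) ≠ 0 := by simpa using hw.ne'
  set A : ℝ≥0∞ := m + c' / ((w / 2 : ℝ≥0) : ℝ≥0∞) with hA
  have hAtop : A ≠ ∞ :=
    ENNReal.add_ne_top.2 ⟨ENNReal.natCast_ne_top m, ENNReal.div_ne_top hc'.ne_top hw2⟩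
  have hcont : Continuous fun δ : ℝ≥0 => c' + A * (2 * (δ : ℝ≥0∞)) :=
    continuous_const.add ((ENNReal.continuous_const_mul hAtop).comp
      ((ENNReal.continuous_const_mul ENNReal.ofNat_ne_top).comp ENNReal.continuous_coe))
  have hsmall : ∀ᶠ δ : ℝ≥0 in 𝓝 0, c' + A * (2 * (δ : ℝ≥0∞)) < Metric.ediam γ :=
    hcont.continuousAt.eventually (gt_mem_nhds (by simpa using hc'))
  have hle : ∀ᶠ δ : ℝ≥0 in 𝓝 0, 2 * δ < w :=
    (continuous_const.mul continuous_id).continuousAt.eventually (gt_mem_nhds (by simpa using hw))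
  obtain ⟨δ, ⟨hδ, hδw⟩, hδ0⟩ :=
    (((hsmall.and hle).filter_mono nhdsWithin_le_nhds).and self_mem_nhdsWithin :
      ∀ᶠ δ : ℝ≥0 in 𝓝[>] 0, _).exists
  filter_upwards [hconv δ (by exact_mod_cast hδ0)] with n hn
  by_contra! hlt
  refine hδ.not_ge ((ediam_le_hausdorffMeasure_add_of_subset_thickening (hK n) (hfin n) (hcard n)
    hγc hw hδw.le hwV (hγK.trans hn)).trans ?_)
  rw [hA]
  gcongr

/-- For finitely many disjoint continua in the limit set, the sum of the diameters is at most the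
lower limit of the lengths of the approximating sets. -/
theorem sum_ediam_le_liminf_hausdorffMeasure {K : ℕ → Set X} {Klim : Set X} {m : ℕ}
    (hK : ∀ n, IsCompact (K n)) (hfin : ∀ n, Finite (ConnectedComponents (K n)))
    (hcard : ∀ n, Nat.card (ConnectedComponents (K n)) ≤ m)
    (hconv : ∀ δ > 0, ∀ᶠ n in atTop, Klim ⊆ Metric.thickening δ (K n))
    {ι : Type*} (T : Finset ι) (γ : ι → Set X) (hdisj : (T : Set ι).PairwiseDisjoint γ)
    (hγ : ∀ i ∈ T, IsCompact (γ i)) (hγc : ∀ i ∈ T, IsPreconnected (γ i))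
    (hγK : ∀ i ∈ T, γ i ⊆ Klim) {V : Set X} (hV : IsOpen V) (hγV : ∀ i ∈ T, γ i ⊆ V) :
    ∑ i ∈ T, Metric.ediam (γ i) ≤ atTop.liminf (fun n => μH[1] (K n ∩ V)) := by
  classical
  induction T using Finset.induction_on generalizing V with
  | empty => simp
  | insert a T ha ih =>
    rw [Finset.coe_insert, pairwiseDisjoint_insert_of_notMem (by simpa using ha)] at hdisj
    simp only [Finset.forall_mem_insert] at hγ hγc hγK hγV
    have hTc : IsCompact (⋃ i ∈ T, γ i) := T.isCompact_biUnion hγ.2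
    obtain ⟨O₁, O₂, hO₁, hO₂, haO, hTO, hO⟩ := SeparatedNhds.of_isCompact_isCompact hγ.1 hTc
      (disjoint_iUnion₂_right.2 hdisj.2)
    rw [Finset.sum_insert ha]
    have h₁ := ediam_le_liminf_hausdorffMeasure hK hfin hcard hconv hγ.1 hγc.1 hγK.1
      (hV.inter hO₁) (subset_inter hγV.1 haO)
    have h₂ := ih hdisj.1 hγ.2 hγc.2 hγK.2 (hV.inter hO₂)
      fun i hi => subset_inter (hγV.2 i hi) ((subset_biUnion_of_mem (u := γ) hi).trans hTO)
    refine (add_le_add h₁ h₂).trans ((ENNReal.liminf_add_liminf_le _ _).trans ?_)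
    refine liminf_le_liminf (Eventually.of_forall fun n => ?_)
    rw [← measure_union]
    · exact measure_mono (union_subset (inter_subset_inter_right _ inter_subset_left)
        (inter_subset_inter_right _ inter_subset_left))
    · exact hO.mono (inter_subset_right.trans inter_subset_right)
        (inter_subset_right.trans inter_subset_right)
    · exact (hK n).measurableSet.inter (hV.inter hO₂).measurableSet

/-- Vitali-type estimate: a set finely covered by closed sets of diameter comparable to their radius
has length at most `L` if disjoint finite subfamilies have total diameter at most `L`. -/
theorem hausdorffMeasure_le_of_fine_cover {ι : Type*} {s : Set X} {L : ℝ≥0∞} (t : Set ι)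
    (B : ι → Set X) (c : ι → X) (r : ι → ℝ) (hr : ∀ a ∈ t, 0 < r a)
    (hB : ∀ a ∈ t, B a ⊆ Metric.closedBall (c a) (r a)) (hc : ∀ a ∈ t, c a ∈ B a)
    (hcl : ∀ a ∈ t, IsClosed (B a)) (hdiam : ∀ a ∈ t, ENNReal.ofReal (r a) ≤ Metric.ediam (B a))
    (hfine : ∀ x ∈ s, ∀ ε > 0, ∃ a ∈ t, c a = x ∧ r a ≤ ε)
    (hL : ∀ T : Finset ι, (T : Set ι) ⊆ t → (T : Set ι).PairwiseDisjoint B →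
      ∑ a ∈ T, Metric.ediam (B a) ≤ L) :
    μH[1] s ≤ L := by
  classical
  rcases eq_or_ne L ∞ with rfl | hLtop
  · exact le_top
  have hcover : ∀ ε : ℝ, 0 < ε → ∃ (u : Set ι) (A : u → Set X), Countable u ∧
      (∀ a, Metric.ediam (A a) ≤ 10 * ENNReal.ofReal ε) ∧ s ⊆ ⋃ a, A a ∧
      ∑' a, Metric.ediam (A a) ≤ L + 10 * ENNReal.ofReal ε := by
    intro ε hε
    obtain ⟨u, hut, hud, hu⟩ := Vitali.exists_disjoint_subfamily_covering_enlargement B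
      {a ∈ t | r a ≤ ε} r 2 one_lt_two (fun a ha => (hr a ha.1).le) ε (fun a ha => ha.2)
      (fun a ha => ⟨c a, hc a ha.1⟩)
    have hsumL : ∑' a : u, Metric.ediam (B a) ≤ L := by
      rw [ENNReal.tsum_eq_iSup_sum]
      refine iSup_le fun T => ?_
      have hTu : ((T.map (Function.Embedding.subtype _) : Finset ι) : Set ι) ⊆ u := by
        intro a ha
        obtain ⟨b, -, rfl⟩ := Finset.mem_map.1 (Finset.mem_coe.1 ha)
        exact b.2
      have := hL (T.map (Function.Embedding.subtype _)) (fun a ha => (hut (hTu ha)).1)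
        (hud.subset hTu)
      simpa using this
    have hne : ∑' a : u, Metric.ediam (B a) ≠ ∞ := (hsumL.trans_lt hLtop.lt_top).ne
    have hpos : ∀ a : u, 0 < Metric.ediam (B a) := fun a =>
      (ENNReal.ofReal_pos.2 (hr a (hut a.2).1)).trans_le (hdiam a (hut a.2).1)
    have hcount : Countable u := by
      have := Summable.countable_support_ennreal hne
      rw [Function.support_eq_univ fun a => (hpos a).ne'] at this
      exact countable_univ_iff.1 this
    obtain ⟨T, hT⟩ := ((ENNReal.tendsto_tsum_compl_atTop_zero hne).eventually
      (gt_mem_nhds (ENNReal.ofReal_pos.2 hε))).exists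
    let A : u → Set X := fun a => if a ∈ T then B a else Metric.closedBall (c a) (5 * r a)
    have hball : ∀ a : u, Metric.ediam (Metric.closedBall (c a) (5 * r a)) ≤
        10 * ENNReal.ofReal (r a) := by
      intro a
      have hra := (hr a (hut a.2).1).le
      rw [← Metric.closedEBall_ofReal (by positivity)]
      refine Metric.ediam_closedEBall_le.trans_eq ?_
      rw [ENNReal.ofReal_mul (by norm_num), ← mul_assoc, ENNReal.ofReal_ofNat]
      norm_num
    refine ⟨u, A, hcount, fun a => ?_, fun x hx => ?_, ?_⟩
    · refine (Metric.ediam_mono ?_).trans ((hball a).trans ?_)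
      · by_cases ha : a ∈ T
        · simp only [A, if_pos ha]
          exact (hB a (hut a.2).1).trans
            (Metric.closedBall_subset_closedBall (by linarith [hr a (hut a.2).1]))
        · simp only [A, if_neg ha, subset_rfl]
      · gcongr
        exact (hut a.2).2
    · by_cases hxT : x ∈ ⋃ a ∈ T, B a
      · obtain ⟨a, ha, hxa⟩ := mem_iUnion₂.1 hxT
        exact mem_iUnion.2 ⟨a, by simpa only [A, if_pos ha] using hxa⟩
      · have hclosed : IsClosed (⋃ a ∈ T, B a) :=
          T.finite_toSet.isClosed_biUnion fun a _ => hcl a (hut a.2).1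
        obtain ⟨ρ, hρ, hρT⟩ := Metric.isOpen_iff.1 hclosed.isOpen_compl x hxT
        obtain ⟨a, hat, rfl, har⟩ := hfine x hx (min ε (ρ / 2)) (by positivity)
        obtain ⟨b, hbu, ⟨z, hza, hzb⟩, hab⟩ := hu a ⟨hat, har.trans (min_le_left _ _)⟩
        have hzc := Metric.mem_closedBall.1 (hB a hat hza)
        have hbT : (⟨b, hbu⟩ : u) ∉ T := fun hbT => by
          refine hρT (Metric.mem_ball.2 (hzc.trans_lt ?_)) (mem_iUnion₂.2 ⟨⟨b, hbu⟩, hbT, hzb⟩)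
          linarith [har.trans (min_le_right _ _)]
        refine mem_iUnion.2 ⟨⟨b, hbu⟩, ?_⟩
        simp only [A, if_neg hbT, Metric.mem_closedBall]
        have hzb' := Metric.mem_closedBall.1 (hB b (hut hbu).1 hzb)
        have := dist_triangle_left (c a) (c b) z
        have := hr b (hut hbu).1
        linarith
    · rw [← ENNReal.sum_add_tsum_compl T]
      refine add_le_add ?_ ?_
      · rw [Finset.sum_congr rfl fun a ha => by rw [show A a = B a from if_pos ha]]
        exact (ENNReal.sum_le_tsum T).trans hsumL
      · refine le_trans (ENNReal.tsum_le_tsum fun a => ?_)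
          ((ENNReal.tsum_mul_left (a := 10)).trans_le (mul_le_mul_right hT.le 10))
        have ha : (a : u) ∉ T := fun h => a.2 (Finset.mem_coe.2 h)
        rw [show A a = Metric.closedBall (c a) (5 * r a) from if_neg ha]
        refine (hball a).trans ?_
        gcongr
        exact hdiam a (hut (a : u).2).1
  have hε : ∀ n : ℕ, (0 : ℝ) < 1 / (n + 1) := fun n => by positivity
  choose u A hu hA hs hsum using fun n : ℕ => hcover (1 / (n + 1)) (hε n)
  have hlim : Tendsto (fun n : ℕ => 10 * ENNReal.ofReal (1 / ((n : ℝ) + 1))) atTop (𝓝 0) := by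
    have := ENNReal.tendsto_ofReal (tendsto_one_div_add_atTop_nhds_zero_nat (𝕜 := ℝ))
    simpa using ENNReal.Tendsto.const_mul this (Or.inr ENNReal.ofNat_ne_top)
  refine (Measure.hausdorffMeasure_le_liminf_tsum 1 s _ hlim A
    (Eventually.of_forall hA) (Eventually.of_forall hs)).trans ?_
  simp only [ENNReal.rpow_one]
  refine (liminf_le_liminf (Eventually.of_forall hsum)).trans_eq ?_
  simpa using (tendsto_const_nhds.add hlim).liminf_eq


/-- Gołąb's theorem in a metric space, with the Hausdorff convergence expressed by thickenings. -/
theorem hausdorffMeasure_inter_le_liminf {K : ℕ → Set X} {Klim U : Set X} {m : ℕ}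
    (hK : ∀ n, IsCompact (K n)) (hfin : ∀ n, Finite (ConnectedComponents (K n)))
    (hcard : ∀ n, Nat.card (ConnectedComponents (K n)) ≤ m) (hKlim : IsCompact Klim)
    (hconv : ∀ δ > 0, ∀ᶠ n in atTop, Klim ⊆ Metric.thickening δ (K n))
    (hconv' : ∀ δ > 0, ∀ᶠ n in atTop, K n ⊆ Metric.thickening δ Klim) (hU : IsOpen U) :
    μH[1] (Klim ∩ U) ≤ atTop.liminf (fun n => μH[1] (K n ∩ U)) := by
  set E := {x ∈ Klim | connectedComponentIn Klim x ⊆ {x}} with hE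
  have hE0 : μH[1] E = 0 := by
    have := Measure.nullSingletonClass_hausdorff X (zero_lt_one' ℝ)
    exact (finite_setOf_connectedComponentIn_subset_singleton hfin hcard hKlim hconv
      hconv').measure_zero _
  rw [← measure_sdiff_null hE0]
  let B : X × ℝ → Set X := fun a => connectedComponentIn (Klim ∩ Metric.closedBall a.1 a.2) a.1
  have hBc : ∀ a, IsClosed (B a) := fun a =>
    (hKlim.isClosed.inter Metric.isClosed_closedBall).isClosed_connectedComponentIn _
  have hBK : ∀ a, B a ⊆ Klim := fun a =>
    (connectedComponentIn_subset _ _).trans inter_subset_left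
  have hBball : ∀ a, B a ⊆ Metric.closedBall a.1 a.2 := fun a =>
    (connectedComponentIn_subset _ _).trans inter_subset_right
  refine hausdorffMeasure_le_of_fine_cover
    {a : X × ℝ | a.1 ∈ Klim ∧ 0 < a.2 ∧ Metric.closedBall a.1 a.2 ⊆ U ∧
      ∃ y ∈ connectedComponentIn Klim a.1, a.2 < dist y a.1}
    B Prod.fst Prod.snd (fun a ha => ha.2.1) (fun a _ => hBball a)
    (fun a ha => mem_connectedComponentIn ⟨ha.1, Metric.mem_closedBall_self ha.2.1.le⟩)
    (fun a _ => hBc a) ?_ ?_ ?_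
  · rintro ⟨x, r⟩ ⟨hx, hr, -, y, hy, hyr⟩
    have hxr : x ∈ Metric.closedBall x r := Metric.mem_closedBall_self hr.le
    have hnot : ¬ B (x, r) ⊆ Metric.ball x r := by
      intro hsub
      have heq := connectedComponentIn_inter_eq_of_subset hKlim Metric.isClosed_closedBall
        Metric.isOpen_ball Metric.ball_subset_closedBall hx hxr hsub
      rw [← heq] at hy
      exact (Metric.mem_closedBall.1 (hBball (x, r) hy)).not_gt hyr
    obtain ⟨z, hz, hzr⟩ := not_subset.1 hnot
    refine le_trans ?_ (Metric.edist_le_ediam_of_mem hz (mem_connectedComponentIn ⟨hx, hxr⟩))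
    rw [edist_dist]
    exact ENNReal.ofReal_le_ofReal (not_lt.1 hzr)
  · rintro x ⟨⟨hxK, hxU⟩, hxE⟩ ε hε
    obtain ⟨y, hy, hyx⟩ : ∃ y ∈ connectedComponentIn Klim x, y ≠ x :=
      not_subset.1 fun hsub => hxE ⟨hxK, hsub⟩
    obtain ⟨ρ, hρ, hρU⟩ := Metric.nhds_basis_closedBall.mem_iff.1 (hU.mem_nhds hxU)
    have hd := dist_pos.2 hyx
    have hmin : 0 < min ε (min ρ (dist y x / 2)) := by positivity
    refine ⟨(x, min ε (min ρ (dist y x / 2))), ⟨hxK, hmin, ?_, y, hy, ?_⟩, rfl, min_le_left _ _⟩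
    · exact (Metric.closedBall_subset_closedBall
        ((min_le_right _ _).trans (min_le_left _ _))).trans hρU
    · exact ((min_le_right _ _).trans (min_le_right _ _)).trans_lt (half_lt_self hd)
  · intro T hT hdisj
    exact sum_ediam_le_liminf_hausdorffMeasure hK hfin hcard hconv T B hdisj
      (fun a _ => hKlim.of_isClosed_subset (hBc a) (hBK a))
      (fun a _ => isPreconnected_connectedComponentIn) (fun a _ => hBK a) hU
      (fun a ha => (hBball a).trans (hT ha).2.2.1)

end HausdorffMeasure

/-- Gołąb's theorem: if compact sets `K n ⊆ Ω` in the plane, each with at most `m`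
connected components, converge to `Klim` in the Hausdorff metric, then for every open set
`U` we have `ℋ¹(Klim ∩ U) ≤ liminf ℋ¹(K n ∩ U)`. -/
theorem golab_lower_semicontinuity
    (Ω : Set (EuclideanSpace ℝ (Fin 2))) (hΩ : IsCompact Ω)
    (m : ℕ) (hm : 1 ≤ m)
    (K : ℕ → Set (EuclideanSpace ℝ (Fin 2))) (Klim : Set (EuclideanSpace ℝ (Fin 2)))
    (hKc : ∀ n, IsCompact (K n)) (hKΩ : ∀ n, K n ⊆ Ω)
    (hfin : ∀ n, Finite (ConnectedComponents (K n)))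
    (hcard : ∀ n, Nat.card (ConnectedComponents (K n)) ≤ m)
    (hKlim : IsCompact Klim)
    (hconv : Tendsto (fun n => EMetric.hausdorffEdist (K n) Klim) atTop (𝓝 0)) :
    ∀ U : Set (EuclideanSpace ℝ (Fin 2)), IsOpen U →
      μH[1] (Klim ∩ U) ≤ atTop.liminf (fun n => μH[1] (K n ∩ U)) := by
  have hsub : ∀ {s t : Set (EuclideanSpace ℝ (Fin 2))} {δ : ℝ},
      Metric.hausdorffEDist s t < ENNReal.ofReal δ → s ⊆ Metric.thickening δ t := by
    intro s t δ h x hx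
    obtain ⟨y, hy, hxy⟩ := Metric.exists_edist_lt_of_hausdorffEDist_lt hx h
    rw [edist_lt_ofReal] at hxy
    exact Metric.mem_thickening_iff.2 ⟨y, hy, hxy⟩
  have hev : ∀ δ > (0 : ℝ), ∀ᶠ n in atTop,
      Metric.hausdorffEDist (K n) Klim < ENNReal.ofReal δ := fun δ hδ =>
    hconv.eventually (gt_mem_nhds (ENNReal.ofReal_pos.2 hδ))
  intro U hU
  refine hausdorffMeasure_inter_le_liminf hKc hfin hcard hKlim (fun δ hδ => ?_)
    (fun δ hδ => (hev δ hδ).mono fun n hn => hsub hn) hU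
  filter_upwards [hev δ hδ] with n hn
  rw [Metric.hausdorffEDist_comm] at hn
  exact hsub hn
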